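/- Let K ≥ 1 and α_1,…,α_K be real numbers, and let Z(F) be the multiset of all numbers ρ ± α_i, where ρ ranges over the non-trivial zeros of ζ (with multiplicity) and i = 1,…,K. Let τ > 0 be a real number with Re ρ + α_i ≤ τ/2 and Re ρ − α_i ≤ τ/2 for every non-trivial zero ρ of ζ and every i. Let 0 < ϑ < 1, and for each non-trivial zero ρ of ζ let ρ' be an approximation with Re ρ' = Re ρ and |ρ − ρ'| ≤ ϑ, chosen conjugate-symmetrically (the approximation of conj ρ is conj ρ'). Assume every non-trivial zero ρ of ζ satisfies |Im ρ| ≥ 14.13 and that N(t) ≤ (5/4)·t·log t for all t ≥ 14.13. Then for every positive integer n and every real T, the difference E between the truncated sum ∑_{z ∈ Z(F), |Im z| ≤ T} (1 − (z/(z−τ))^n) computed with the true zeros and the same sum computed with the approximated zeros satisfies |E| ≤ 1.30·K·ϑ·n·τ/(1−ϑ). -/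

import Mathlib

open Complex Filter Finset

noncomputable section

/-- `ρ` is a non-trivial zero of the Riemann zeta function. -/
def IsNontrivialZero (ρ : ℂ) : Prop :=
  riemannZeta ρ = 0 ∧ 0 < ρ.re ∧ ρ.re < 1

/-- The multiplicity of `ρ` as a zero of `ζ`. -/
noncomputable def zetaMult (ρ : ℂ) : ℕ :=
  sInf {k : ℕ | iteratedDeriv k riemannZeta ρ ≠ 0}

/-- The zero-counting function `N(t)`: the number of non-trivial zeros `ρ` of `ζ` with
`0 < Im ρ ≤ t`, counted with multiplicity. -/
noncomputable def zetaN (t : ℝ) : ℝ :=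
  ∑' ρ : {ρ : ℂ // IsNontrivialZero ρ ∧ 0 < ρ.im ∧ ρ.im ≤ t}, (zetaMult ρ : ℝ)

/-- The truncated `τ`-Li sum for `F(s) = ∏_{i=1}^{K} ζ(s−α_i)ζ(s+α_i)` at height `T`,
computed from the images of the non-trivial zeros of `ζ` under `f` (with the multiplicities
of the true zeros). Taking `f = id` gives the true sum; taking `f` an approximation gives the
computed sum. -/
noncomputable def approxLiSum (K : ℕ) (α : Fin K → ℝ) (τ : ℝ) (n : ℕ) (T : ℝ)
    (f : ℂ → ℂ) : ℂ :=
  ∑' ρ : {ρ : ℂ // IsNontrivialZero ρ ∧ |ρ.im| ≤ T},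
    (zetaMult ρ : ℂ) * ∑ i,
      ((1 - ((f ρ + (α i : ℂ)) / (f ρ + (α i : ℂ) - (τ : ℂ))) ^ n) +
       (1 - ((f ρ - (α i : ℂ)) / (f ρ - (α i : ℂ) - (τ : ℂ))) ^ n))

section Kernel

open HurwitzZeta MeasureTheory Set

lemma one_le_evenKernel_zero {t : ℝ} (ht : 0 < t) : 1 ≤ evenKernel 0 t := by
  have h := hasSum_int_evenKernel 0 ht
  rw [QuotientAddGroup.mk_zero] at h
  simpa using le_hasSum h 0 fun n _ => (Real.exp_pos _).le

lemma evenKernel_zero_sub_nonneg_of_pos {t : ℝ} (ht : 0 < t) :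
    0 ≤ evenKernel 0 t - t ^ (-(1 / 2) : ℝ) := by
  rw [evenKernel_functional_equation, ← evenKernel_eq_cosKernel_of_zero, Real.rpow_neg ht.le,
    one_div, sub_nonneg]
  exact le_mul_of_one_le_right (by positivity) (one_le_evenKernel_zero (by positivity))

lemma hurwitzEvenFEPair_zero_f_modif_eq_norm {t : ℝ} (ht : 0 < t) :
    (hurwitzEvenFEPair 0).f_modif t = (‖(hurwitzEvenFEPair 0).f_modif t‖ : ℂ) := by
  suffices h : ∃ r : ℝ, 0 ≤ r ∧ (hurwitzEvenFEPair 0).f_modif t = (r : ℂ) by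
    obtain ⟨r, hr, h⟩ := h
    rw [h, Complex.norm_real, Real.norm_of_nonneg hr]
  rcases lt_trichotomy t 1 with h | rfl | h
  · refine ⟨_, evenKernel_zero_sub_nonneg_of_pos ht, ?_⟩
    simp [WeakFEPair.f_modif, hurwitzEvenFEPair, h, ht, h.le]
  · exact ⟨0, le_rfl, by simp [WeakFEPair.f_modif]⟩
  · refine ⟨_, sub_nonneg.2 (one_le_evenKernel_zero ht), ?_⟩
    simp [WeakFEPair.f_modif, hurwitzEvenFEPair, h, h.le]

lemma norm_mellin_ofReal_of_eq_norm {f : ℝ → ℂ} (hf : ∀ t, 0 < t → f t = (‖f t‖ : ℂ)) (a : ℝ) :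
    ‖mellin f a‖ = ∫ t in Ioi (0 : ℝ), t ^ (a - 1) * ‖f t‖ := by
  have h : mellin f a = ((∫ t in Ioi (0 : ℝ), t ^ (a - 1) * ‖f t‖ : ℝ) : ℂ) := by
    rw [mellin, ← integral_complex_ofReal]
    refine setIntegral_congr_fun measurableSet_Ioi fun t ht => ?_
    simp only [smul_eq_mul]
    rw [hf t ht]
    have ht' : (0 : ℝ) ≤ t := le_of_lt ht
    push_cast [Complex.ofReal_cpow ht']
    simp
  rw [h, Complex.norm_real, Real.norm_of_nonneg]
  exact setIntegral_nonneg measurableSet_Ioi fun t ht =>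
    mul_nonneg (Real.rpow_nonneg (le_of_lt ht) _) (norm_nonneg _)

lemma MellinConvergent.integrableOn_rpow_mul_norm {f : ℝ → ℂ} {s : ℂ}
    (hf : MellinConvergent f s) :
    IntegrableOn (fun t : ℝ => t ^ (s.re - 1) * ‖f t‖) (Ioi 0) := by
  refine (integrableOn_congr_fun (fun t ht => ?_) measurableSet_Ioi).1 hf.norm
  simp only [norm_smul]
  rw [Complex.norm_cpow_eq_rpow_re_of_pos ht]
  simp

lemma norm_mellin_le_of_re_mem_Icc {f : ℝ → ℂ} (hf : ∀ t, 0 < t → f t = (‖f t‖ : ℂ))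
    (hconv : ∀ s, MellinConvergent f s) {a b : ℝ} {s : ℂ} (hs : s.re ∈ Icc b a) :
    ‖mellin f s‖ ≤ ‖mellin f a‖ + ‖mellin f b‖ := by
  have hint (c : ℝ) : IntegrableOn (fun t : ℝ => t ^ (c - 1) * ‖f t‖) (Ioi 0) := by
    simpa using (hconv c).integrableOn_rpow_mul_norm
  rw [norm_mellin_ofReal_of_eq_norm hf, norm_mellin_ofReal_of_eq_norm hf,
    ← integral_add (hint a) (hint b)]
  refine (norm_integral_le_integral_norm _).trans ?_
  refine setIntegral_mono_on (hconv s).norm ((hint a).add (hint b)) measurableSet_Ioi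
    fun t (ht : 0 < t) => ?_
  rw [norm_smul, Complex.norm_cpow_eq_rpow_re_of_pos ht, ← add_mul]
  refine mul_le_mul_of_nonneg_right ?_ (norm_nonneg _)
  have ha : 0 ≤ t ^ (a - 1) := Real.rpow_nonneg ht.le _
  have hb : 0 ≤ t ^ (b - 1) := Real.rpow_nonneg ht.le _
  rcases le_total 1 t with h | h
  · have : t ^ (s - 1).re ≤ t ^ (a - 1) :=
      Real.rpow_le_rpow_of_exponent_le h (by simpa using hs.2)
    linarith
  · have : t ^ (s - 1).re ≤ t ^ (b - 1) :=
      Real.rpow_le_rpow_of_exponent_ge ht h (by simpa using hs.1)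
    linarith

lemma norm_completedRiemannZeta₀_le {a : ℝ} {s : ℂ} (hs : s.re ∈ Icc (1 - a) a) :
    ‖completedRiemannZeta₀ s‖ ≤ 2 * ‖completedRiemannZeta₀ a‖ := by
  have hconv : ∀ s, MellinConvergent (hurwitzEvenFEPair 0).f_modif s := fun s =>
    ((hurwitzEvenFEPair 0).isStrongFEPair_toStrongFEPair.hasMellin s).1
  have key := norm_mellin_le_of_re_mem_Icc (fun t ht => hurwitzEvenFEPair_zero_f_modif_eq_norm ht)
    hconv (a := a / 2) (b := (1 - a) / 2) (s := s / 2)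
    (by simp only [Set.mem_Icc, Complex.div_ofNat_re] at hs ⊢; constructor <;> linarith [hs.1, hs.2])
  have hsym := completedRiemannZeta₀_one_sub (a : ℂ)
  have hΛ (z : ℂ) : completedRiemannZeta₀ z = mellin (hurwitzEvenFEPair 0).f_modif (z / 2) / 2 :=
    rfl
  have h1 : ‖completedRiemannZeta₀ (1 - a)‖ = ‖completedRiemannZeta₀ a‖ := by rw [hsym]
  rw [hΛ, hΛ, norm_div, norm_div] at h1
  rw [hΛ, hΛ, norm_div, norm_div]
  push_cast at key
  norm_num at h1 ⊢
  linarith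

end Kernel

section CompletedZeta

lemma norm_riemannZeta_natCast_le_two {k : ℕ} (hk : 2 ≤ k) : ‖riemannZeta k‖ ≤ 2 := by
  rw [zeta_nat_eq_tsum_of_gt_one (by lia)]
  refine (tsum_of_norm_bounded hasSum_zeta_two fun n => ?_).trans ?_
  · rcases Nat.eq_zero_or_pos n with rfl | hn
    · simp [show k ≠ 0 by lia]
    · rw [norm_div, norm_one, norm_pow, Complex.norm_natCast]
      have : (1 : ℝ) ≤ n := by exact_mod_cast hn
      gcongr
  · nlinarith [Real.pi_lt_d2, Real.pi_pos]

lemma completedRiemannZeta₀_eq (s : ℂ) :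
    completedRiemannZeta₀ s = completedRiemannZeta s + 1 / s + 1 / (1 - s) := by
  rw [completedRiemannZeta_eq]; ring

lemma completedRiemannZeta_two_mul_natCast_add_two (k : ℕ) :
    completedRiemannZeta (2 * (k + 1) : ℕ) =
      ((Real.pi : ℂ) ^ (k + 1))⁻¹ * (k.factorial : ℂ) * riemannZeta (2 * (k + 1) : ℕ) := by
  have h0 : ((2 * (k + 1) : ℕ) : ℂ) ≠ 0 := by exact_mod_cast (by lia)
  have hre : 0 < ((2 * (k + 1) : ℕ) : ℂ).re := by
    rw [Complex.natCast_re]; positivity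
  have hΓ : Gammaℝ (2 * (k + 1) : ℕ) = ((Real.pi : ℂ) ^ (k + 1))⁻¹ * (k.factorial : ℂ) := by
    rw [Complex.Gammaℝ_def, ← Complex.Gamma_nat_eq_factorial]
    congr 1
    · rw [← Complex.cpow_natCast, ← Complex.cpow_neg]
      congr 1; push_cast; ring
    · congr 1; push_cast; ring
  rw [riemannZeta_def_of_ne_zero h0, ← hΓ, mul_div_cancel₀ _ (Complex.Gammaℝ_ne_zero_of_re_pos hre)]

lemma norm_completedRiemannZeta₀_half_le_two : ‖completedRiemannZeta₀ (1 / 2)‖ ≤ 2 := by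
  refine (norm_completedRiemannZeta₀_le (a := 2) (by norm_num)).trans ?_
  have h := completedRiemannZeta_two_mul_natCast_add_two 0
  norm_num [riemannZeta_two] at h
  have hpi : (Real.pi : ℂ) ≠ 0 := by exact_mod_cast Real.pi_ne_zero
  have h2 : completedRiemannZeta₀ (2 : ℝ) = ((Real.pi / 6 - 1 / 2 : ℝ) : ℂ) := by
    push_cast
    rw [completedRiemannZeta₀_eq, h]
    field_simp
    ring
  rw [h2, Complex.norm_real, Real.norm_eq_abs]
  have : |Real.pi / 6 - 1 / 2| ≤ 1 := by
    rw [abs_le]; constructor <;> linarith [Real.pi_gt_three, Real.pi_lt_d2]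
  linarith

lemma norm_completedRiemannZeta₀_ofReal_le :
    ‖completedRiemannZeta₀ (120 : ℝ)‖ ≤ 10 ^ 52 := by
  have h := completedRiemannZeta_two_mul_natCast_add_two 59
  rw [show 2 * (59 + 1) = 120 from rfl, show 59 + 1 = 60 from rfl] at h
  rw [show ((120 : ℝ) : ℂ) = ((120 : ℕ) : ℂ) by norm_num, completedRiemannZeta₀_eq, h]
  refine (norm_add₃_le).trans ?_
  rw [norm_mul, norm_mul, norm_inv, norm_pow, Complex.norm_real, Complex.norm_natCast,
    Real.norm_of_nonneg Real.pi_pos.le]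
  have h3 : (Real.pi ^ 60)⁻¹ ≤ ((3 : ℝ) ^ 60)⁻¹ := by
    gcongr; exact Real.pi_gt_three.le
  have hz : ‖riemannZeta (120 : ℕ)‖ ≤ 2 := norm_riemannZeta_natCast_le_two (by norm_num)
  have hfac : ((Nat.factorial 59 : ℕ) : ℝ) ≤ 2 * 10 ^ 80 := by
    exact_mod_cast (by decide : Nat.factorial 59 ≤ 2 * 10 ^ 80)
  have hmain : (Real.pi ^ 60)⁻¹ * ((Nat.factorial 59 : ℕ) : ℝ) * ‖riemannZeta (120 : ℕ)‖ ≤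
      ((3 : ℝ) ^ 60)⁻¹ * (2 * 10 ^ 80) * 2 := by gcongr
  have e1 : ‖(1 : ℂ) / (120 : ℕ)‖ ≤ 1 := by norm_num
  have e2 : ‖(1 : ℂ) / (1 - (120 : ℕ))‖ ≤ 1 := by norm_num
  have : ((3 : ℝ) ^ 60)⁻¹ * (2 * 10 ^ 80) * 2 + 1 + 1 ≤ 10 ^ 52 := by norm_num
  linarith

/-- Twice the Riemann `ξ`-function, `s (s - 1) Λ(s)`, as an entire function. -/
def zetaXi (s : ℂ) : ℂ := s * (s - 1) * completedRiemannZeta₀ s + 1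

lemma differentiable_zetaXi : Differentiable ℂ zetaXi := by
  unfold zetaXi
  have := differentiable_completedZeta₀
  fun_prop

lemma analyticAt_zetaXi (s : ℂ) : AnalyticAt ℂ zetaXi s := differentiable_zetaXi.analyticAt s

lemma zetaXi_one_sub (s : ℂ) : zetaXi (1 - s) = zetaXi s := by
  unfold zetaXi
  rw [completedRiemannZeta₀_one_sub]; ring

lemma riemannZeta_mul_eq_zetaXi_mul {s : ℂ} (h0 : s ≠ 0) (h1 : s ≠ 1) :
    riemannZeta s * (s * (s - 1)) = zetaXi s * (Gammaℝ s)⁻¹ := by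
  have h1' : 1 - s ≠ 0 := sub_ne_zero.2 h1.symm
  rw [riemannZeta_def_of_ne_zero h0, completedRiemannZeta_eq, zetaXi]
  field_simp
  ring

lemma one_half_le_norm_zetaXi_half : 1 / 2 ≤ ‖zetaXi (1 / 2)‖ := by
  have h : zetaXi (1 / 2) = 1 - (1 / 4) * completedRiemannZeta₀ (1 / 2) := by
    unfold zetaXi; ring
  rw [h]
  have h1 := norm_sub_norm_le (1 : ℂ) ((1 / 4) * completedRiemannZeta₀ (1 / 2))
  rw [norm_mul] at h1
  norm_num at h1 ⊢
  have h2 := norm_completedRiemannZeta₀_half_le_two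
  norm_num at h2
  linarith

lemma norm_zetaXi_le {s : ℂ} (hs : ‖s - 1 / 2‖ ≤ 239 / 2) : ‖zetaXi s‖ ≤ 10 ^ 57 := by
  have hre : |(s - 1 / 2).re| ≤ 239 / 2 := (Complex.abs_re_le_norm _).trans hs
  rw [abs_le] at hre
  norm_num at hre
  have hΛ := norm_completedRiemannZeta₀_le (a := 120) (s := s) ⟨by linarith, by linarith⟩
  have hΛ' := norm_completedRiemannZeta₀_ofReal_le
  have e1 : ‖s‖ ≤ 120 := by
    have := norm_add_le (s - 1 / 2) (1 / 2)
    norm_num at this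
    norm_num at hs
    linarith
  have e2 : ‖s - 1‖ ≤ 120 := by
    have := norm_sub_le (s - 1 / 2) (1 / 2)
    rw [show s - 1 / 2 - 1 / 2 = s - 1 by ring] at this
    norm_num at this
    norm_num at hs
    linarith
  have hΛ'' : ‖completedRiemannZeta₀ s‖ ≤ 2 * 10 ^ 52 := by linarith
  unfold zetaXi
  refine (norm_add_le _ _).trans ?_
  rw [norm_mul, norm_mul, norm_one]
  have : ‖s‖ * ‖s - 1‖ * ‖completedRiemannZeta₀ s‖ ≤ 120 * 120 * (2 * 10 ^ 52) := by gcongr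
  norm_num at this ⊢
  linarith

end CompletedZeta

section Zeros

lemma IsNontrivialZero.ne_zero {ρ : ℂ} (h : IsNontrivialZero ρ) : ρ ≠ 0 := by
  rintro rfl
  simpa using h.2.1

lemma IsNontrivialZero.ne_one {ρ : ℂ} (h : IsNontrivialZero ρ) : ρ ≠ 1 := by
  rintro rfl
  simpa using h.2.2

lemma isNontrivialZero_iff_zetaXi {ρ : ℂ} :
    IsNontrivialZero ρ ↔ zetaXi ρ = 0 ∧ 0 < ρ.re ∧ ρ.re < 1 := by
  refine and_congr_left fun ⟨h0, h1⟩ => ?_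
  have hne0 : ρ ≠ 0 := by rintro rfl; simp at h0
  have hne1 : ρ ≠ 1 := by rintro rfl; simp at h1
  have key := riemannZeta_mul_eq_zetaXi_mul hne0 hne1
  have hΓ := Complex.Gammaℝ_ne_zero_of_re_pos h0
  have h1' := sub_ne_zero.2 hne1
  constructor
  · intro h
    rw [h, zero_mul, eq_comm] at key
    simpa [hΓ] using key
  · intro h
    rw [h, zero_mul] at key
    simpa [hne0, h1'] using key

lemma IsNontrivialZero.one_sub {ρ : ℂ} (h : IsNontrivialZero ρ) : IsNontrivialZero (1 - ρ) := by
  rw [isNontrivialZero_iff_zetaXi] at h ⊢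
  rw [zetaXi_one_sub]
  refine ⟨h.1, ?_, ?_⟩ <;> simp [h.2]

lemma analyticOrderAt_zetaXi_ne_top (s : ℂ) : analyticOrderAt zetaXi s ≠ ⊤ := by
  rw [Ne, AnalyticOnNhd.analyticOrderAt_eq_top_iff_eq_zero s analyticAt_zetaXi]
  intro h
  have h1 := one_half_le_norm_zetaXi_half
  rw [h] at h1
  norm_num at h1

lemma analyticOrderAt_riemannZeta_eq_zetaXi {ρ : ℂ} (h : IsNontrivialZero ρ) :
    analyticOrderAt riemannZeta ρ = analyticOrderAt zetaXi ρ := by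
  have hζ : AnalyticAt ℂ riemannZeta ρ := by
    refine DifferentiableOn.analyticAt (s := {1}ᶜ) differentiableOn_riemannZeta ?_
    exact isOpen_compl_singleton.mem_nhds h.ne_one
  have hp : AnalyticAt ℂ (fun s : ℂ => s * (s - 1)) ρ := by fun_prop
  have hΓ : AnalyticAt ℂ (fun s : ℂ => (Complex.Gammaℝ s)⁻¹) ρ :=
    Complex.differentiable_Gammaℝ_inv.analyticAt ρ
  have hev : riemannZeta * (fun s : ℂ => s * (s - 1)) =ᶠ[nhds ρ]
      zetaXi * (fun s : ℂ => (Complex.Gammaℝ s)⁻¹) := by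
    filter_upwards [isOpen_compl_singleton.mem_nhds h.ne_one,
      isOpen_compl_singleton.mem_nhds h.ne_zero] with s h1 h0
    exact riemannZeta_mul_eq_zetaXi_mul h0 h1
  have hord := analyticOrderAt_congr hev
  rw [analyticOrderAt_mul hζ hp, analyticOrderAt_mul (analyticAt_zetaXi ρ) hΓ,
    hp.analyticOrderAt_eq_zero.2 (mul_ne_zero h.ne_zero (sub_ne_zero.2 h.ne_one)),
    hΓ.analyticOrderAt_eq_zero.2 (inv_ne_zero (Complex.Gammaℝ_ne_zero_of_re_pos h.2.1)),
    add_zero, add_zero] at hord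
  exact hord

lemma coe_zetaMult_eq_analyticOrderAt {ρ : ℂ} (h : IsNontrivialZero ρ) :
    (zetaMult ρ : ℕ∞) = analyticOrderAt zetaXi ρ := by
  have hζ : AnalyticAt ℂ riemannZeta ρ := by
    refine DifferentiableOn.analyticAt (s := {1}ᶜ) differentiableOn_riemannZeta ?_
    exact isOpen_compl_singleton.mem_nhds h.ne_one
  have hord := analyticOrderAt_riemannZeta_eq_zetaXi h
  obtain ⟨m, hm⟩ := ENat.ne_top_iff_exists.1 (analyticOrderAt_zetaXi_ne_top ρ)
  rw [← hm] at hord ⊢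
  obtain ⟨hlt, hne⟩ := (analyticOrderAt_eq_nat_iff_iteratedDeriv_eq_zero hζ).1 hord
  congr 1
  refine le_antisymm (Nat.sInf_le hne) (le_csInf ⟨m, hne⟩ fun k hk => ?_)
  by_contra! hkm
  exact hk (hlt k hkm)

lemma zetaMult_one_sub {ρ : ℂ} (h : IsNontrivialZero ρ) : zetaMult (1 - ρ) = zetaMult ρ := by
  have hcomp : zetaXi ∘ (fun s => 1 - s) = zetaXi := funext zetaXi_one_sub
  have hd : deriv (fun s : ℂ => 1 - s) ρ ≠ 0 := by simp
  have := analyticOrderAt_comp_of_deriv_ne_zero (f := zetaXi) (z₀ := ρ)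
    (g := fun s : ℂ => 1 - s) (by fun_prop) hd
  rw [hcomp, ← coe_zetaMult_eq_analyticOrderAt h, ← coe_zetaMult_eq_analyticOrderAt h.one_sub]
    at this
  exact_mod_cast this.symm

lemma finite_setOf_isNontrivialZero_abs_im_le (T : ℝ) :
    {ρ : ℂ | IsNontrivialZero ρ ∧ |ρ.im| ≤ T}.Finite := by
  have hco : zetaXi ⁻¹' {0}ᶜ ∈ codiscrete ℂ := by
    refine AnalyticOnNhd.preimage_zero_mem_codiscrete (x := 1 / 2)
      (fun z _ => analyticAt_zetaXi z) fun h => ?_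
    have h1 := one_half_le_norm_zetaXi_half
    rw [h] at h1
    norm_num at h1
  have hfin := (isCompact_closedBall (0 : ℂ) (1 + T)).finite_sdiff_of_mem_codiscreteWithin
    (codiscreteWithin_mono (Set.subset_univ _) hco)
  refine hfin.subset fun ρ hρ => ⟨?_, ?_⟩
  · obtain ⟨⟨-, h0, h1⟩, hT⟩ := hρ
    rw [mem_closedBall_zero_iff]
    refine (Complex.norm_le_abs_re_add_abs_im ρ).trans ?_
    rw [abs_of_pos h0]
    linarith
  · simp [(isNontrivialZero_iff_zetaXi.1 hρ.1).1]

lemma tsum_subtype_eq_sum_toFinset {ι E : Type*} [AddCommMonoid E] [TopologicalSpace E]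
    {p : ι → Prop} (hp : {x | p x}.Finite) (f : ι → E) :
    ∑' x : {x // p x}, f x = ∑ x ∈ hp.toFinset, f x := by
  have : Fintype {x // p x} := hp.fintype
  rw [tsum_fintype]
  exact (Finset.sum_subtype _ (by simp) f).symm

lemma sum_zetaMult_le_zetaN {S : Finset ℂ} {t : ℝ}
    (hS : ∀ ρ ∈ S, IsNontrivialZero ρ ∧ 0 < ρ.im ∧ ρ.im ≤ t) :
    ∑ ρ ∈ S, (zetaMult ρ : ℝ) ≤ zetaN t := by
  have hfin : {ρ : ℂ | IsNontrivialZero ρ ∧ 0 < ρ.im ∧ ρ.im ≤ t}.Finite :=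
    (finite_setOf_isNontrivialZero_abs_im_le t).subset fun ρ hρ =>
      ⟨hρ.1, by rw [abs_of_pos hρ.2.1]; exact hρ.2.2⟩
  rw [zetaN, tsum_subtype_eq_sum_toFinset hfin fun ρ => (zetaMult ρ : ℝ)]
  refine Finset.sum_le_sum_of_subset_of_nonneg (fun ρ hρ => ?_) fun _ _ _ => Nat.cast_nonneg _
  simpa using hS ρ hρ

lemma sum_zetaMult_mul_log_le {S : Finset ℂ}
    (hS : ∀ ρ ∈ S, IsNontrivialZero ρ ∧ ‖1 / 2 - ρ‖ ≤ 239 / 2) :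
    ∑ ρ ∈ S, (zetaMult ρ : ℝ) * Real.log (239 / 2 * ‖1 / 2 - ρ‖⁻¹) ≤ 134 := by
  have habs : |(239 / 2 : ℝ)| = 239 / 2 := abs_of_pos (by norm_num)
  have han : AnalyticOnNhd ℂ zetaXi (Metric.closedBall (1 / 2) |239 / 2|) :=
    fun z _ => analyticAt_zetaXi z
  have hhalf := one_half_le_norm_zetaXi_half
  have hne : zetaXi (1 / 2) ≠ 0 := by
    intro h
    rw [h] at hhalf
    norm_num at hhalf
  have hJ := han.circleAverage_log_norm (by norm_num) hne
  have hM : Real.circleAverage (fun z => Real.log ‖zetaXi z‖) (1 / 2) (239 / 2) ≤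
      Real.log (10 ^ 57) := by
    refine Real.circleAverage_mono_on_of_le_circle
      (han.mono Metric.sphere_subset_closedBall).meromorphicOn.circleIntegrable_log_norm
      fun z hz => ?_
    rw [habs, mem_sphere_iff_norm] at hz
    rcases (norm_nonneg (zetaXi z)).eq_or_lt with h | h
    · rw [← h, Real.log_zero]
      exact Real.log_nonneg (by norm_num)
    · exact Real.log_le_log h (norm_zetaXi_le hz.le)
  have hlog : Real.log (10 ^ 57) - Real.log ‖zetaXi (1 / 2)‖ ≤ 134 := by
    rw [← Real.log_div (by norm_num) (by simpa using hne),
      Real.log_le_iff_le_exp (by positivity)]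
    have h1 : (10 : ℝ) ^ 57 / ‖zetaXi (1 / 2)‖ ≤ 10 ^ 57 / (1 / 2) := by gcongr
    have h2 : (2.7 : ℝ) ^ 134 ≤ Real.exp 1 ^ 134 := by
      gcongr
      linarith [Real.exp_one_gt_d9]
    rw [← Real.exp_nat_mul] at h2
    norm_num at h1 h2 ⊢
    linarith
  set D := MeromorphicOn.divisor zetaXi (Metric.closedBall (1 / 2) |239 / 2|) with hD
  have hfin : (Function.support fun u => (D u : ℝ) * Real.log (239 / 2 * ‖1 / 2 - u‖⁻¹)).Finite :=
    (D.finiteSupport (isCompact_closedBall _ _)).subset fun u hu => by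
      contrapose! hu
      simp only [Function.mem_support, ne_eq, not_not] at hu ⊢
      simp [hu]
  have hterm_nonneg (u : ℂ) : 0 ≤ (D u : ℝ) * Real.log (239 / 2 * ‖1 / 2 - u‖⁻¹) := by
    have hDn : 0 ≤ D u := MeromorphicOn.AnalyticOnNhd.divisor_nonneg han u
    by_cases hu : u ∈ Metric.closedBall (1 / 2 : ℂ) |239 / 2|
    · rcases (norm_nonneg (1 / 2 - u)).eq_or_lt with h0 | h0
      · rw [← h0]; simp
      · refine mul_nonneg (by exact_mod_cast hDn) (Real.log_nonneg ?_)
        rw [habs, mem_closedBall_iff_norm'] at hu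
        rw [← div_eq_mul_inv, le_div_iff₀ h0, one_mul]
        exact hu
    · rw [Function.locallyFinsuppWithin.apply_eq_zero_of_notMem _ hu]
      simp
  have hsum : ∑ ρ ∈ S, (zetaMult ρ : ℝ) * Real.log (239 / 2 * ‖1 / 2 - ρ‖⁻¹) ≤
      ∑ᶠ u, (D u : ℝ) * Real.log (239 / 2 * ‖1 / 2 - u‖⁻¹) := by
    classical
    rw [finsum_eq_sum_of_support_subset (s := S ∪ hfin.toFinset) _ (by simp)]
    refine le_trans (le_of_eq (Finset.sum_congr rfl fun ρ hρ => ?_))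
      (Finset.sum_le_sum_of_subset_of_nonneg Finset.subset_union_left
        fun u _ _ => hterm_nonneg u)
    have hmem : ρ ∈ Metric.closedBall (1 / 2 : ℂ) |239 / 2| := by
      rw [habs, mem_closedBall_iff_norm']
      exact (hS ρ hρ).2
    rw [hD, MeromorphicOn.AnalyticOnNhd.divisor_apply han hmem, ← coe_zetaMult_eq_analyticOrderAt (hS ρ hρ).1]
    simp
  linarith

end Zeros

section PowerSums

lemma inv_sq_le_log_div {ρ : ℂ} (h0 : 0 < ρ.re) (h1 : ρ.re < 1) (hlow : 14.13 ≤ |ρ.im|)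
    (hup : |ρ.im| ≤ 100) :
    (ρ.im ^ 2)⁻¹ ≤ Real.log (239 / 2 * ‖1 / 2 - ρ‖⁻¹) / 420 := by
  have hlow2 : 14.13 ^ 2 ≤ ρ.im ^ 2 := by
    rw [← sq_abs ρ.im]
    gcongr
  have hup2 : ρ.im ^ 2 ≤ 100 ^ 2 := by
    rw [← sq_abs ρ.im]
    gcongr
  norm_num at hlow2 hup2
  have hnorm : ‖1 / 2 - ρ‖ ^ 2 = (1 / 2 - ρ.re) ^ 2 + ρ.im ^ 2 := by
    rw [← Complex.normSq_eq_norm_sq, Complex.normSq_apply]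
    simp
    ring
  have hpos : 0 < ‖1 / 2 - ρ‖ := by
    refine (norm_nonneg _).lt_of_ne fun h => ?_
    rw [← h] at hnorm
    nlinarith [sq_nonneg (1 / 2 - ρ.re)]
  obtain ⟨x, hx⟩ : ∃ x, ρ.im ^ 2 = 199.9 * x - 1 / 4 :=
    ⟨(ρ.im ^ 2 + 1 / 4) / 199.9, by ring⟩
  have hnle : ‖1 / 2 - ρ‖ ^ 2 ≤ 199.9 * x := by
    rw [hnorm, hx]
    nlinarith
  rw [hx] at hlow2 hup2
  have hx1 : 1 ≤ x := by linarith
  have hx51 : x ≤ 51 := by linarith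
  have hlog51 : Real.log 51 ≤ 4 := by
    rw [Real.log_le_iff_le_exp (by norm_num)]
    have h2 : (2.7 : ℝ) ^ 4 ≤ Real.exp 1 ^ 4 := by
      gcongr
      linarith [Real.exp_one_gt_d9]
    rw [← Real.exp_nat_mul] at h2
    norm_num at h2 ⊢
    linarith
  have hlog71 : 4.25 ≤ Real.log 71.4 := by
    have h2 : Real.exp 1 ^ 17 ≤ (2.7182818286 : ℝ) ^ 17 := by
      gcongr
      exact Real.exp_one_lt_d9.le
    rw [← Real.exp_nat_mul] at h2
    have h3 : Real.exp ((17 : ℕ) * 1) ≤ 71.4 ^ 4 := h2.trans (by norm_num)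
    have h4 := (Real.le_log_iff_exp_le (by norm_num)).2 h3
    rw [Real.log_pow] at h4
    norm_num at h4 ⊢
    linarith
  have hchord : x * Real.log x ≤ 4.08 * (x - 1) := by
    have h2 := Real.convexOn_mul_log.2 (show (1 : ℝ) ∈ Set.Ici 0 by norm_num)
      (show (51 : ℝ) ∈ Set.Ici 0 by norm_num) (show 0 ≤ (51 - x) / 50 by linarith)
      (show 0 ≤ (x - 1) / 50 by linarith) (by ring)
    have h3 : ((51 - x) / 50) • (1 : ℝ) + ((x - 1) / 50) • (51 : ℝ) = x := by
      simp only [smul_eq_mul]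
      ring
    rw [h3] at h2
    simp only [smul_eq_mul, Real.log_one, mul_zero, zero_add] at h2
    nlinarith
  have hlogx : 0 ≤ Real.log x := Real.log_nonneg hx1
  have hlog : 4.25 - Real.log x ≤ 2 * Real.log (239 / 2 * ‖1 / 2 - ρ‖⁻¹) := by
    have h2 : (71.4 : ℝ) / x ≤ (239 / 2 * ‖1 / 2 - ρ‖⁻¹) ^ 2 := by
      rw [mul_pow, inv_pow, ← div_eq_mul_inv, div_le_div_iff₀ (by positivity) (by positivity)]
      nlinarith
    have h3 := Real.log_le_log (by positivity) h2
    rw [Real.log_div (by norm_num) (by positivity), Real.log_pow] at h3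
    push_cast at h3
    linarith
  have hkey : 420 ≤ Real.log (239 / 2 * ‖1 / 2 - ρ‖⁻¹) * ρ.im ^ 2 := by
    rw [hx]
    have h2 : 840 ≤ (4.25 - Real.log x) * (199.9 * x - 1 / 4) := by nlinarith
    have h3 := mul_le_mul_of_nonneg_right hlog (show 0 ≤ 199.9 * x - 1 / 4 by linarith)
    linarith
  have him : 0 < ρ.im ^ 2 := by linarith
  rw [inv_le_iff_one_le_mul₀ him]
  linarith

open MeasureTheory in
/-- Partial summation: a counting function of size at most `(5/4) t log t` beyond `X` bounds the
sum of inverse squares beyond `X`. -/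
lemma sum_mul_inv_sq_le {ι : Type*} (S : Finset ι) (m γ : ι → ℝ) {X : ℝ} (hX : 1 ≤ X)
    (hm : ∀ i ∈ S, 0 ≤ m i) (hγ : ∀ i ∈ S, X ≤ γ i)
    (hcount : ∀ t, X < t → ∑ i ∈ S with γ i ≤ t, m i ≤ 5 / 4 * t * Real.log t) :
    ∑ i ∈ S, m i * (γ i ^ 2)⁻¹ ≤ 5 / 2 * (Real.log X + 1) / X := by
  have hX0 : 0 < X := by linarith
  have hcube (c : ℝ) (hc : 0 < c) : IntegrableOn (fun t : ℝ => 2 / t ^ 3) (Set.Ioi c) ∧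
      ∫ t in Set.Ioi c, 2 / t ^ 3 = (c ^ 2)⁻¹ := by
    have hderiv : ∀ t ∈ Set.Ici c, HasDerivAt (fun t : ℝ => -(t ^ 2)⁻¹) (2 / t ^ 3) t := by
      intro t ht
      have ht0 : t ≠ 0 := (hc.trans_le ht).ne'
      refine ((hasDerivAt_pow 2 t).inv (pow_ne_zero 2 ht0)).neg.congr_deriv ?_
      field_simp
      ring
    have hnonneg : ∀ t ∈ Set.Ioi c, 0 ≤ 2 / t ^ 3 := fun t ht =>
      div_nonneg zero_le_two (pow_nonneg (hc.trans ht).le 3)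
    have hlim : Tendsto (fun t : ℝ => -(t ^ 2)⁻¹) atTop (nhds 0) := by
      simpa using (tendsto_inv_atTop_zero.comp (tendsto_pow_atTop (α := ℝ) two_ne_zero)).neg
    refine ⟨integrableOn_Ioi_deriv_of_nonneg' hderiv hnonneg hlim, ?_⟩
    rw [integral_Ioi_of_hasDerivAt_of_nonneg' hderiv hnonneg hlim]
    ring
  have hlogint : IntegrableOn (fun t : ℝ => 5 / 2 * (Real.log t / t ^ 2)) (Set.Ioi X) ∧
      ∫ t in Set.Ioi X, 5 / 2 * (Real.log t / t ^ 2) = 5 / 2 * (Real.log X + 1) / X := by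
    have hderiv : ∀ t ∈ Set.Ici X, HasDerivAt (fun t : ℝ => -(5 / 2 * (Real.log t + 1) / t))
        (5 / 2 * (Real.log t / t ^ 2)) t := by
      intro t ht
      have ht0 : t ≠ 0 := (hX0.trans_le ht).ne'
      refine ((((Real.hasDerivAt_log ht0).add_const 1).const_mul (5 / 2)).div
        (hasDerivAt_id t) ht0).neg.congr_deriv ?_
      simp only [id]
      field_simp
      ring
    have hnonneg : ∀ t ∈ Set.Ioi X, 0 ≤ 5 / 2 * (Real.log t / t ^ 2) := fun t ht =>
      mul_nonneg (by norm_num) (div_nonneg (Real.log_nonneg (hX.trans ht.le)) (sq_nonneg t))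
    have hlim : Tendsto (fun t : ℝ => -(5 / 2 * (Real.log t + 1) / t)) atTop (nhds 0) := by
      have h1 : Tendsto (fun t : ℝ => Real.log t / t) atTop (nhds 0) :=
        Real.isLittleO_log_id_atTop.tendsto_div_nhds_zero
      have h2 := ((h1.add tendsto_inv_atTop_zero).const_mul (5 / 2)).neg
      simp only [add_zero, mul_zero, neg_zero] at h2
      refine h2.congr fun t => ?_
      ring
    refine ⟨integrableOn_Ioi_deriv_of_nonneg' hderiv hnonneg hlim, ?_⟩
    rw [integral_Ioi_of_hasDerivAt_of_nonneg' hderiv hnonneg hlim]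
    ring
  have hind (i : ι) (hi : i ∈ S) :
      IntegrableOn ((Set.Ioi (γ i)).indicator fun t : ℝ => 2 / t ^ 3) (Set.Ioi X) ∧
      ∫ t in Set.Ioi X, (Set.Ioi (γ i)).indicator (fun t : ℝ => 2 / t ^ 3) t =
        (γ i ^ 2)⁻¹ := by
    have hc := hcube (γ i) (hX0.trans_le (hγ i hi))
    refine ⟨((integrable_indicator_iff measurableSet_Ioi).2 hc.1).integrableOn, ?_⟩
    rw [setIntegral_indicator measurableSet_Ioi,
      Set.inter_eq_right.2 (Set.Ioi_subset_Ioi (hγ i hi)), hc.2]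
  calc ∑ i ∈ S, m i * (γ i ^ 2)⁻¹
      = ∑ i ∈ S, ∫ t in Set.Ioi X,
          m i * (Set.Ioi (γ i)).indicator (fun t : ℝ => 2 / t ^ 3) t := by
        refine Finset.sum_congr rfl fun i hi => ?_
        rw [integral_const_mul, (hind i hi).2]
    _ = ∫ t in Set.Ioi X, ∑ i ∈ S,
          m i * (Set.Ioi (γ i)).indicator (fun t : ℝ => 2 / t ^ 3) t :=
        (integral_finsetSum S fun i hi => (hind i hi).1.const_mul (m i)).symm
    _ ≤ ∫ t in Set.Ioi X, 5 / 2 * (Real.log t / t ^ 2) := by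
        refine setIntegral_mono_on
          (integrable_finsetSum S fun i hi => (hind i hi).1.const_mul (m i))
          hlogint.1 measurableSet_Ioi fun t ht => ?_
        have ht0 : 0 < t := hX0.trans ht
        have hpos : 0 < 2 / t ^ 3 := by positivity
        calc ∑ i ∈ S, m i * (Set.Ioi (γ i)).indicator (fun t : ℝ => 2 / t ^ 3) t
            ≤ ∑ i ∈ S, if γ i ≤ t then m i * (2 / t ^ 3) else 0 := by
              refine Finset.sum_le_sum fun i hi => ?_
              by_cases h : γ i < t
              · simp [h, h.le]
              · rw [Set.indicator_of_notMem (by simpa using h), mul_zero]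
                split_ifs
                · exact mul_nonneg (hm i hi) hpos.le
                · exact le_rfl
          _ = (∑ i ∈ S with γ i ≤ t, m i) * (2 / t ^ 3) := by
              rw [← Finset.sum_filter, Finset.sum_mul]
          _ ≤ 5 / 4 * t * Real.log t * (2 / t ^ 3) := by
              gcongr
              exact hcount t ht
          _ = 5 / 2 * (Real.log t / t ^ 2) := by
              field_simp
              ring
    _ = 5 / 2 * (Real.log X + 1) / X := hlogint.2

lemma log_hundred_le : Real.log 100 ≤ 5 := by
  rw [Real.log_le_iff_le_exp (by norm_num)]
  have h2 : (2.7 : ℝ) ^ 5 ≤ Real.exp 1 ^ 5 := by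
    gcongr
    linarith [Real.exp_one_gt_d9]
  rw [← Real.exp_nat_mul] at h2
  norm_num at h2 ⊢
  linarith

lemma sum_zetaMult_mul_inv_sq_le_of_hundred_lt {S : Finset ℂ}
    (hN : ∀ t : ℝ, 14.13 ≤ t → zetaN t ≤ (5 / 4) * t * Real.log t)
    (hS : ∀ ρ ∈ S, IsNontrivialZero ρ ∧ 100 < ρ.im) :
    ∑ ρ ∈ S, (zetaMult ρ : ℝ) * (ρ.im ^ 2)⁻¹ ≤ 0.15 := by
  have h := sum_mul_inv_sq_le S (fun ρ => (zetaMult ρ : ℝ)) Complex.im (X := 100) (by norm_num)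
    (fun _ _ => Nat.cast_nonneg _) (fun ρ hρ => (hS ρ hρ).2.le) fun t ht => by
      refine (sum_zetaMult_le_zetaN (t := t) fun ρ hρ => ?_).trans (hN t (by linarith))
      obtain ⟨hρS, hρt⟩ := Finset.mem_filter.1 hρ
      exact ⟨(hS ρ hρS).1, by linarith [(hS ρ hρS).2], hρt⟩
  refine h.trans ?_
  linarith [log_hundred_le]

lemma sum_zetaMult_mul_inv_sq_le {S : Finset ℂ}
    (him : ∀ ρ : ℂ, IsNontrivialZero ρ → 14.13 ≤ |ρ.im|)
    (hN : ∀ t : ℝ, 14.13 ≤ t → zetaN t ≤ (5 / 4) * t * Real.log t)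
    (hS : ∀ ρ ∈ S, IsNontrivialZero ρ) :
    ∑ ρ ∈ S, (zetaMult ρ : ℝ) * (ρ.im ^ 2)⁻¹ ≤ 0.65 := by
  classical
  have hsmall : ∑ ρ ∈ S with |ρ.im| ≤ 100, (zetaMult ρ : ℝ) * (ρ.im ^ 2)⁻¹ ≤ 134 / 420 := by
    calc ∑ ρ ∈ S with |ρ.im| ≤ 100, (zetaMult ρ : ℝ) * (ρ.im ^ 2)⁻¹
        ≤ ∑ ρ ∈ S with |ρ.im| ≤ 100,
            (zetaMult ρ : ℝ) * Real.log (239 / 2 * ‖1 / 2 - ρ‖⁻¹) / 420 := by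
          refine Finset.sum_le_sum fun ρ hρ => ?_
          obtain ⟨hρS, hρ100⟩ := Finset.mem_filter.1 hρ
          have hz := hS ρ hρS
          rw [mul_div_assoc]
          gcongr
          exact inv_sq_le_log_div hz.2.1 hz.2.2 (him ρ hz) hρ100
      _ ≤ 134 / 420 := by
          rw [← Finset.sum_div]
          gcongr
          refine sum_zetaMult_mul_log_le fun ρ hρ => ?_
          obtain ⟨hρS, hρ100⟩ := Finset.mem_filter.1 hρ
          have hz := hS ρ hρS
          refine ⟨hz, (Complex.norm_le_abs_re_add_abs_im _).trans ?_⟩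
          have hre : |(1 / 2 - ρ).re| ≤ 1 := by
            rw [abs_le]
            constructor <;> norm_num <;> linarith [hz.2.1, hz.2.2]
          have him' : |(1 / 2 - ρ).im| = |ρ.im| := by simp
          linarith
  have hpos : ∑ ρ ∈ S with 100 < ρ.im, (zetaMult ρ : ℝ) * (ρ.im ^ 2)⁻¹ ≤ 0.15 :=
    sum_zetaMult_mul_inv_sq_le_of_hundred_lt hN fun ρ hρ =>
      ⟨hS ρ (Finset.mem_filter.1 hρ).1, (Finset.mem_filter.1 hρ).2⟩
  have hneg : ∑ ρ ∈ S with ρ.im < -100, (zetaMult ρ : ℝ) * (ρ.im ^ 2)⁻¹ ≤ 0.15 := by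
    have himage : ∑ ρ ∈ S with ρ.im < -100, (zetaMult ρ : ℝ) * (ρ.im ^ 2)⁻¹ =
        ∑ ρ ∈ (S.filter fun ρ => ρ.im < -100).image fun ρ => 1 - ρ,
          (zetaMult ρ : ℝ) * (ρ.im ^ 2)⁻¹ := by
      rw [Finset.sum_image fun a _ b _ hab => sub_right_injective hab]
      refine Finset.sum_congr rfl fun ρ hρ => ?_
      rw [zetaMult_one_sub (hS ρ (Finset.mem_filter.1 hρ).1)]
      simp
    rw [himage]
    refine sum_zetaMult_mul_inv_sq_le_of_hundred_lt hN fun ρ hρ => ?_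
    obtain ⟨σ, hσ, rfl⟩ := Finset.mem_image.1 hρ
    obtain ⟨hσS, hσ100⟩ := Finset.mem_filter.1 hσ
    refine ⟨(hS σ hσS).one_sub, ?_⟩
    simp
    linarith
  have hsplit : ∑ ρ ∈ S, (zetaMult ρ : ℝ) * (ρ.im ^ 2)⁻¹ ≤
      ∑ ρ ∈ S with |ρ.im| ≤ 100, (zetaMult ρ : ℝ) * (ρ.im ^ 2)⁻¹ +
      (∑ ρ ∈ S with 100 < ρ.im, (zetaMult ρ : ℝ) * (ρ.im ^ 2)⁻¹ +
      ∑ ρ ∈ S with ρ.im < -100, (zetaMult ρ : ℝ) * (ρ.im ^ 2)⁻¹) := by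
    simp only [Finset.sum_filter, ← Finset.sum_add_distrib]
    refine Finset.sum_le_sum fun ρ _ => ?_
    have hnonneg : 0 ≤ (zetaMult ρ : ℝ) * (ρ.im ^ 2)⁻¹ := by positivity
    rcases le_or_gt |ρ.im| 100 with h | h
    · rw [if_pos h]
      split_ifs <;> linarith
    · rcases lt_abs.1 h with h' | h'
      · rw [if_pos h']
        split_ifs <;> linarith
      · rw [if_pos (show ρ.im < -100 by linarith)]
        split_ifs <;> linarith
  linarith

end PowerSums

section Terms

lemma norm_pow_sub_pow_le {w v : ℂ} (hw : ‖w‖ ≤ 1) (hv : ‖v‖ ≤ 1) (n : ℕ) :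
    ‖w ^ n - v ^ n‖ ≤ n * ‖w - v‖ := by
  induction n with
  | zero => simp
  | succ n ih =>
    have h : w ^ (n + 1) - v ^ (n + 1) = w * (w ^ n - v ^ n) + v ^ n * (w - v) := by ring
    rw [h]
    refine (norm_add_le _ _).trans ?_
    rw [norm_mul, norm_mul, norm_pow]
    have h1 := mul_le_mul hw ih (norm_nonneg _) zero_le_one
    have h2 := mul_le_mul_of_nonneg_right (pow_le_one₀ (norm_nonneg v) hv (n := n))
      (norm_nonneg (w - v))
    push_cast
    linarith

lemma norm_div_sub_le_one {z : ℂ} {τ : ℝ} (hτ : 0 < τ) (hz : z.re ≤ τ / 2) :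
    ‖z / (z - τ)‖ ≤ 1 := by
  rw [norm_div]
  refine div_le_one_of_le₀ ?_ (norm_nonneg _)
  rw [← sq_le_sq₀ (norm_nonneg _) (norm_nonneg _), ← Complex.normSq_eq_norm_sq,
    ← Complex.normSq_eq_norm_sq, Complex.normSq_apply, Complex.normSq_apply]
  simp
  nlinarith

lemma norm_one_sub_pow_sub_le {z w : ℂ} {τ ϑ γ : ℝ} (hτ : 0 < τ) (hz : z.re ≤ τ / 2)
    (hw : w.re = z.re) (hzim : z.im = γ) (hγ : 1 ≤ |γ|) (hϑ : ϑ < 1) (hzw : ‖z - w‖ ≤ ϑ)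
    (n : ℕ) :
    ‖(1 - (z / (z - τ)) ^ n) - (1 - (w / (w - τ)) ^ n)‖ ≤ n * τ * ϑ / (1 - ϑ) * (γ ^ 2)⁻¹ := by
  have hϑ0 : 0 ≤ ϑ := (norm_nonneg _).trans hzw
  have hϑ1 : 0 < 1 - ϑ := by linarith
  have hz1 : |γ| ≤ ‖z - τ‖ := by
    simpa [hzim] using Complex.abs_im_le_norm (z - τ)
  have hw1 : |γ| * (1 - ϑ) ≤ ‖w - τ‖ := by
    have h1 : |w.im| ≤ ‖w - τ‖ := by simpa using Complex.abs_im_le_norm (w - τ)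
    have h2 : |γ - w.im| ≤ ϑ := by
      simpa [hzim] using (Complex.abs_im_le_norm (z - w)).trans hzw
    have h3 := abs_sub_abs_le_abs_sub γ w.im
    nlinarith
  have hγ0 : 0 < |γ| := by linarith
  have hz0 : 0 < ‖z - τ‖ := hγ0.trans_le hz1
  have hw0 : 0 < ‖w - τ‖ := (mul_pos hγ0 hϑ1).trans_le hw1
  have hdiff : ‖z / (z - τ) - w / (w - τ)‖ ≤ τ * ϑ / (1 - ϑ) * (γ ^ 2)⁻¹ := by
    have hid : z / (z - τ) - w / (w - τ) = τ * (w - z) / ((z - τ) * (w - τ)) := by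
      have := norm_pos_iff.1 hz0
      have := norm_pos_iff.1 hw0
      field_simp
      ring
    rw [hid, norm_div, norm_mul, norm_mul, Complex.norm_real, Real.norm_of_nonneg hτ.le,
      norm_sub_rev w z]
    calc τ * ‖z - w‖ / (‖z - τ‖ * ‖w - τ‖) ≤ τ * ϑ / (|γ| * (|γ| * (1 - ϑ))) := by gcongr
      _ = τ * ϑ / (1 - ϑ) * (γ ^ 2)⁻¹ := by
        rw [← sq_abs γ]
        field_simp
  have hpow := norm_pow_sub_pow_le (norm_div_sub_le_one hτ hz)
    (norm_div_sub_le_one hτ (hw.trans_le hz)) n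
  rw [sub_sub_sub_cancel_left, norm_sub_rev]
  refine hpow.trans ?_
  calc n * ‖z / (z - τ) - w / (w - τ)‖ ≤ n * (τ * ϑ / (1 - ϑ) * (γ ^ 2)⁻¹) := by gcongr
    _ = n * τ * ϑ / (1 - ϑ) * (γ ^ 2)⁻¹ := by ring

end Terms

/-- For `F(s) = ∏ ζ(s−α_i)ζ(s+α_i)` and `τ` with all zeros of `F` in the
half-plane `Re z ≤ τ/2`, if each zero of `ζ` is replaced by a conjugate-symmetric
approximation with the same real part within distance `ϑ < 1`, then the truncated `τ`-Li sums
computed with the true and the approximated zeros differ by at most `1.30·K·ϑ·n·τ/(1−ϑ)`. -/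
theorem approx_error_shifted_zeta (K : ℕ) (hK : 1 ≤ K) (α : Fin K → ℝ)
    (τ : ℝ) (hτ : 0 < τ)
    (hre : ∀ ρ : ℂ, IsNontrivialZero ρ → ∀ i, ρ.re + α i ≤ τ / 2 ∧ ρ.re - α i ≤ τ / 2)
    (ϑ : ℝ) (hϑ0 : 0 < ϑ) (hϑ1 : ϑ < 1)
    (approx : ℂ → ℂ)
    (hreEq : ∀ ρ : ℂ, IsNontrivialZero ρ → (approx ρ).re = ρ.re)
    (hbd : ∀ ρ : ℂ, IsNontrivialZero ρ → ‖ρ - approx ρ‖ ≤ ϑ)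
    (hconj : ∀ ρ : ℂ, IsNontrivialZero ρ →
      approx ((starRingEnd ℂ) ρ) = (starRingEnd ℂ) (approx ρ))
    (him : ∀ ρ : ℂ, IsNontrivialZero ρ → 14.13 ≤ |ρ.im|)
    (hN : ∀ t : ℝ, 14.13 ≤ t → zetaN t ≤ (5 / 4) * t * Real.log t)
    (n : ℕ) (hn : 0 < n) (T : ℝ) :
    ‖approxLiSum K α τ n T id - approxLiSum K α τ n T approx‖ ≤
      1.30 * K * ϑ * n * τ / (1 - ϑ) := by
  have hfin := finite_setOf_isNontrivialZero_abs_im_le T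
  have hsum (f : ℂ → ℂ) : approxLiSum K α τ n T f = ∑ ρ ∈ hfin.toFinset,
      (zetaMult ρ : ℂ) * ∑ i,
        ((1 - ((f ρ + (α i : ℂ)) / (f ρ + (α i : ℂ) - (τ : ℂ))) ^ n) +
         (1 - ((f ρ - (α i : ℂ)) / (f ρ - (α i : ℂ) - (τ : ℂ))) ^ n)) :=
    tsum_subtype_eq_sum_toFinset hfin fun ρ => (zetaMult ρ : ℂ) * ∑ i,
        ((1 - ((f ρ + (α i : ℂ)) / (f ρ + (α i : ℂ) - (τ : ℂ))) ^ n) +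
         (1 - ((f ρ - (α i : ℂ)) / (f ρ - (α i : ℂ) - (τ : ℂ))) ^ n))
  have hzero (ρ : ℂ) (hρ : ρ ∈ hfin.toFinset) : IsNontrivialZero ρ :=
    (hfin.mem_toFinset.1 hρ).1
  set C : ℝ := n * τ * ϑ / (1 - ϑ) with hC
  have hC0 : 0 ≤ C := by
    have : 0 < 1 - ϑ := by linarith
    positivity
  rw [hsum, hsum, ← Finset.sum_sub_distrib]
  calc _ ≤ ∑ ρ ∈ hfin.toFinset, 2 * K * C * ((zetaMult ρ : ℝ) * (ρ.im ^ 2)⁻¹) := by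
        refine norm_sum_le_of_le _ fun ρ hρ => ?_
        have hz := hzero ρ hρ
        have hγ : 1 ≤ |ρ.im| := by linarith [him ρ hz]
        rw [← mul_sub, ← Finset.sum_sub_distrib, norm_mul, Complex.norm_natCast]
        calc _ ≤ (zetaMult ρ : ℝ) * ∑ i : Fin K, 2 * (C * (ρ.im ^ 2)⁻¹) := by
              gcongr
              refine norm_sum_le_of_le _ fun i _ => ?_
              have h1 := norm_one_sub_pow_sub_le (z := ρ + α i) (w := approx ρ + α i)
                (γ := ρ.im) hτ (by simpa using (hre ρ hz i).1) (by simp [hreEq ρ hz]) (by simp)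
                hγ hϑ1 (by simpa using hbd ρ hz) n
              have h2 := norm_one_sub_pow_sub_le (z := ρ - α i) (w := approx ρ - α i)
                (γ := ρ.im) hτ (by simpa using (hre ρ hz i).2) (by simp [hreEq ρ hz]) (by simp)
                hγ hϑ1 (by simpa using hbd ρ hz) n
              rw [add_sub_add_comm, two_mul]
              exact (norm_add_le _ _).trans (add_le_add h1 h2)
          _ = 2 * K * C * ((zetaMult ρ : ℝ) * (ρ.im ^ 2)⁻¹) := by
              rw [Finset.sum_const, Finset.card_univ, Fintype.card_fin, nsmul_eq_mul]
              ring
    _ ≤ 2 * K * C * 0.65 := by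
        rw [← Finset.mul_sum]
        gcongr
        exact sum_zetaMult_mul_inv_sq_le him hN hzero
    _ = 1.30 * K * ϑ * n * τ / (1 - ϑ) := by
        rw [hC]
        ring

end
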